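/- arXiv:0810.2780 — 2 statements merged into one kernel-verified Lean document; each statement's English description precedes it below -/
import Mathlib

section
/- Let d, n be positive natural numbers and let B₀, B₁ be disjoint subsets of Fin d. Let V be a unitary matrix over ℂ indexed by binary strings of length n that is phase invariant. Then there exists a unitary matrix V' over ℂ indexed by functions Fin n → Fin d such that for every pair of unit vectors ψ₀, ψ₁ ∈ ℂ^d with the support of ψ₀ contained in B₀ and the support of ψ₁ contained in B₁, and for every binary string y of length n, applying V' to the product vector x ↦ ∏_{j} ψ_{y_j}(x_j) (for x : Fin n → Fin d) yields Σ_{z ∈ {0,1}^n} V_{z,y} · (x ↦ ∏_j ψ_{z_j}(x_j)). In other words, a single unitary V' on (ℂ^d)^{⊗ n} implements V simultaneously in every hidden basis {ψ₀, ψ₁}^{⊗ n} with ψ₀ supported in B₀ and ψ₁ supported in B₁. -/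
open Matrix

/-- Hamming weight of a binary string of length `n`. -/
def hamW {n : ℕ} (y : Fin n → Bool) : ℕ :=
  (Finset.univ.filter fun j => y j = true).card

/-- The phase-shift matrix `U(θ)`: diagonal with `(y,y)` entry `exp(i·H(y)·θ)`. -/
noncomputable def phaseU (n : ℕ) (θ : ℝ) : Matrix (Fin n → Bool) (Fin n → Bool) ℂ :=
  Matrix.diagonal fun y => Complex.exp (Complex.I * (hamW y : ℂ) * (θ : ℂ))

/-- Phase invariance makes the entries between strings of different Hamming weight vanish. -/
theorem entry_eq_zero_of_phase_invariant {n : ℕ} {V : Matrix (Fin n → Bool) (Fin n → Bool) ℂ}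
    (hV : ∀ θ : ℝ, phaseU n θ * V * (phaseU n θ)ᴴ = V) {z y : Fin n → Bool}
    (h : hamW z ≠ hamW y) : V z y = 0 := by
  have hne : (hamW z : ℂ) - (hamW y : ℂ) ≠ 0 := by
    rw [sub_ne_zero]
    exact_mod_cast h
  have key := congrFun (congrFun (hV (Real.pi / ((hamW z : ℝ) - (hamW y : ℝ)))) z) y
  rw [phaseU, diagonal_conjTranspose, mul_diagonal, diagonal_mul, Pi.star_apply,
    Complex.star_def, ← Complex.exp_conj, mul_right_comm, ← Complex.exp_add] at key
  have harg : Complex.I * (hamW z : ℂ) * ((Real.pi / ((hamW z : ℝ) - (hamW y : ℝ)) : ℝ) : ℂ)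
      + (starRingEnd ℂ) (Complex.I * (hamW y : ℂ) *
        ((Real.pi / ((hamW z : ℝ) - (hamW y : ℝ)) : ℝ) : ℂ)) = Real.pi * Complex.I := by
    simp only [map_mul, Complex.conj_I, Complex.conj_ofReal, map_natCast]
    push_cast
    field_simp
    ring
  rw [harg, Complex.exp_pi_mul_I] at key
  linear_combination (-1 / 2 : ℂ) * key

/-- Binary strings of equal Hamming weight become equal after sorting. -/
theorem comp_sort_eq_of_hamW_eq {n : ℕ} {z y : Fin n → Bool} (h : hamW z = hamW y) :
    z ∘ Tuple.sort z = y ∘ Tuple.sort y := by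
  have hc : Fintype.card {j // z j = true} = Fintype.card {j // y j = true} := by
    rw [Fintype.card_subtype, Fintype.card_subtype]
    exact h
  let e := Fintype.equivOfCardEq hc
  have hz : z = y ∘ e.extendSubtype := by
    funext j
    rw [Bool.eq_iff_iff]
    by_cases hj : z j = true
    · exact iff_of_true hj (e.extendSubtype_mem j hj)
    · exact iff_of_false hj (e.extendSubtype_not_mem j hj)
  rw [hz]
  exact Tuple.comp_perm_comp_sort_eq_comp_sort

/-- The binary string recording which letters of `x` lie in `B`. -/
def memPattern {d n : ℕ} (B : Finset (Fin d)) (x : Fin n → Fin d) : Fin n → Bool :=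
  fun j => decide (x j ∈ B)

/-- The word `x` rearranged by the stable sort that moves the letters in `B` to the end. -/
def sortByMem {d n : ℕ} (B : Finset (Fin d)) (x : Fin n → Fin d) : Fin n → Fin d :=
  x ∘ Tuple.sort (memPattern B x)

theorem memPattern_comp {d n : ℕ} (B : Finset (Fin d)) (x : Fin n → Fin d)
    (σ : Equiv.Perm (Fin n)) : memPattern B (x ∘ σ) = memPattern B x ∘ σ := rfl

theorem memPattern_sortByMem {d n : ℕ} (B : Finset (Fin d)) (x : Fin n → Fin d) :
    memPattern B (sortByMem B x) = memPattern B x ∘ Tuple.sort (memPattern B x) := rfl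

/-- A word is determined by its membership pattern and its rearrangement. -/
theorem eq_of_sortByMem_eq {d n : ℕ} {B : Finset (Fin d)} {a b : Fin n → Fin d}
    (hs : sortByMem B a = sortByMem B b) (hp : memPattern B a = memPattern B b) : a = b := by
  unfold sortByMem at hs
  rw [hp] at hs
  exact (Tuple.sort (memPattern B b)).surjective.injective_comp_right hs

/-- A word `t` is a rearrangement of exactly one word of each admissible pattern. -/
theorem sum_sortByMem_eq {d n : ℕ} (B : Finset (Fin d)) (t : Fin n → Fin d)
    (f : (Fin n → Bool) → ℂ) :
    (∑ x : Fin n → Fin d, if sortByMem B x = t then f (memPattern B x) else 0)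
      = ∑ z : Fin n → Bool, if z ∘ Tuple.sort z = memPattern B t then f z else 0 := by
  rw [← Finset.sum_filter, ← Finset.sum_filter]
  have hpat : ∀ z : Fin n → Bool, z ∘ Tuple.sort z = memPattern B t →
      memPattern B (t ∘ (Tuple.sort z).symm) = z := by
    intro z hz
    rw [memPattern_comp, ← hz]
    funext j
    simp
  refine Finset.sum_bij' (fun x _ => memPattern B x) (fun z _ => t ∘ (Tuple.sort z).symm)
    ?_ ?_ ?_ ?_ ?_
  · intro x hx
    simp only [Finset.mem_filter, Finset.mem_univ, true_and] at hx ⊢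
    rw [← hx, memPattern_sortByMem]
  · intro z hz
    simp only [Finset.mem_filter, Finset.mem_univ, true_and] at hz ⊢
    rw [sortByMem, hpat z hz]
    funext j
    simp
  · intro x hx
    simp only [Finset.mem_filter, Finset.mem_univ, true_and] at hx ⊢
    rw [← hx, sortByMem]
    funext j
    simp
  · intro z hz
    simp only [Finset.mem_filter, Finset.mem_univ, true_and] at hz
    exact hpat z hz
  · intros
    rfl

/-- When `f` is supported on strings of the weight of `memPattern B a`, summing over the words
with the same rearrangement as `a` is summing over all binary strings. -/
theorem sum_sortByMem_eq_sum {d n : ℕ} (B : Finset (Fin d)) (a : Fin n → Fin d)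
    (f : (Fin n → Bool) → ℂ) (hf : ∀ z, hamW z ≠ hamW (memPattern B a) → f z = 0) :
    (∑ x : Fin n → Fin d, if sortByMem B x = sortByMem B a then f (memPattern B x) else 0)
      = ∑ z, f z := by
  rw [sum_sortByMem_eq]
  refine Finset.sum_congr rfl fun z _ => ?_
  split_ifs with h
  · rfl
  · refine (hf z fun hw => h ?_).symm
    rw [memPattern_sortByMem]
    exact comp_sort_eq_of_hamW_eq hw

/-- The lift of `V` to words: it acts by `V` on the membership pattern and preserves the
rearrangement. -/
def liftMatrix {d n : ℕ} (B : Finset (Fin d)) (V : Matrix (Fin n → Bool) (Fin n → Bool) ℂ) :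
    Matrix (Fin n → Fin d) (Fin n → Fin d) ℂ :=
  of fun x' x => if sortByMem B x' = sortByMem B x then
    V (memPattern B x') (memPattern B x) else 0

theorem liftMatrix_mem_unitaryGroup {d n : ℕ} (B : Finset (Fin d))
    {V : Matrix (Fin n → Bool) (Fin n → Bool) ℂ} (hVU : V ∈ Matrix.unitaryGroup (Fin n → Bool) ℂ)
    (hV : ∀ θ : ℝ, phaseU n θ * V * (phaseU n θ)ᴴ = V) :
    liftMatrix B V ∈ Matrix.unitaryGroup (Fin n → Fin d) ℂ := by
  rw [mem_unitaryGroup_iff'] at hVU ⊢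
  ext a b
  have hab : (star (liftMatrix B V) * liftMatrix B V) a b =
      if sortByMem B a = sortByMem B b then (star V * V) (memPattern B a) (memPattern B b)
      else 0 := by
    simp only [mul_apply, star_apply, liftMatrix, of_apply]
    split_ifs with h
    · rw [← sum_sortByMem_eq_sum B a (fun z => star (V z (memPattern B a)) * V z (memPattern B b))]
      · refine Finset.sum_congr rfl fun x _ => ?_
        rw [← h]
        split_ifs <;> simp
      · intro z hz
        simp [entry_eq_zero_of_phase_invariant hV hz]
    · refine Finset.sum_eq_zero fun x _ => ?_
      by_cases hx : sortByMem B x = sortByMem B a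
      · rw [if_neg fun hx' => h (hx.symm.trans hx'), mul_zero]
      · rw [if_neg hx, star_zero, zero_mul]
  rw [hab, hVU]
  by_cases h : a = b
  · subst h
    rw [if_pos rfl, one_apply_eq, one_apply_eq]
  · rw [one_apply_ne h]
    split_ifs with hs
    · exact one_apply_ne fun hp => h (eq_of_sortByMem_eq hs hp)
    · rfl

/-- A product vector vanishes off the words whose membership pattern is its label. -/
theorem prod_eq_zero_of_memPattern_ne {d n : ℕ} {B₀ B₁ : Finset (Fin d)} (hB : Disjoint B₀ B₁)
    {ψ₀ ψ₁ : Fin d → ℂ} (h₀ : ∀ i, ψ₀ i ≠ 0 → i ∈ B₀) (h₁ : ∀ i, ψ₁ i ≠ 0 → i ∈ B₁)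
    {y : Fin n → Bool} {x : Fin n → Fin d} (h : memPattern B₁ x ≠ y) :
    ∏ j, (if y j then ψ₁ else ψ₀) (x j) = 0 := by
  obtain ⟨j, hj⟩ := Function.ne_iff.mp h
  refine Finset.prod_eq_zero (Finset.mem_univ j) ?_
  by_contra hne
  refine hj ?_
  cases hy : y j
  · simp only [hy, Bool.false_eq_true, if_false] at hne
    exact decide_eq_false (Finset.disjoint_left.mp hB (h₀ _ hne))
  · simp only [hy, if_true] at hne
    exact decide_eq_true (h₁ _ hne)

/-- The amplitude of a word under its own pattern is invariant under rearrangement. -/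
theorem prod_memPattern_sortByMem {d n : ℕ} (B : Finset (Fin d)) (ψ₀ ψ₁ : Fin d → ℂ)
    (x : Fin n → Fin d) :
    ∏ j, (if memPattern B (sortByMem B x) j then ψ₁ else ψ₀) (sortByMem B x j)
      = ∏ j, (if memPattern B x j then ψ₁ else ψ₀) (x j) :=
  Equiv.prod_comp (Tuple.sort (memPattern B x))
    fun j => (if memPattern B x j then ψ₁ else ψ₀) (x j)

/-- a phase-invariant unitary `V` on the logical qubits can be
implemented by a single unitary `V'` on `(ℂ^d)^{⊗n}` simultaneously in every
hidden basis `{ψ₀, ψ₁}^{⊗n}` with `ψ₀` supported in `B₀` and `ψ₁` supported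
in `B₁`. -/
theorem stmt2 (d n : ℕ) (hd : 0 < d) (hn : 0 < n)
    (B₀ B₁ : Finset (Fin d)) (hB : Disjoint B₀ B₁)
    (V : Matrix (Fin n → Bool) (Fin n → Bool) ℂ)
    (hVU : V ∈ Matrix.unitaryGroup (Fin n → Bool) ℂ)
    (hVinv : ∀ θ : ℝ, phaseU n θ * V * (phaseU n θ)ᴴ = V) :
    ∃ V' : Matrix (Fin n → Fin d) (Fin n → Fin d) ℂ,
      V' ∈ Matrix.unitaryGroup (Fin n → Fin d) ℂ ∧
      ∀ ψ₀ ψ₁ : Fin d → ℂ,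
        (∑ i, Complex.normSq (ψ₀ i)) = 1 →
        (∑ i, Complex.normSq (ψ₁ i)) = 1 →
        (∀ i, ψ₀ i ≠ 0 → i ∈ B₀) →
        (∀ i, ψ₁ i ≠ 0 → i ∈ B₁) →
        ∀ y : Fin n → Bool,
          V'.mulVec (fun x : Fin n → Fin d => ∏ j, (if y j then ψ₁ else ψ₀) (x j))
            = ∑ z : Fin n → Bool,
                V z y • (fun x : Fin n → Fin d => ∏ j, (if z j then ψ₁ else ψ₀) (x j)) := by
  refine ⟨liftMatrix B₁ V, liftMatrix_mem_unitaryGroup B₁ hVU hVinv, ?_⟩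
  intro ψ₀ ψ₁ _ _ h₀ h₁ y
  funext x
  set Q := ∏ j, (if memPattern B₁ x j then ψ₁ else ψ₀) (x j) with hQ
  have hrhs : (∑ z : Fin n → Bool,
      V z y • (fun x : Fin n → Fin d => ∏ j, (if z j then ψ₁ else ψ₀) (x j))) x
        = V (memPattern B₁ x) y * Q := by
    simp only [Finset.sum_apply, Pi.smul_apply, smul_eq_mul]
    refine Finset.sum_eq_single (memPattern B₁ x) (fun z _ hz => ?_) (by simp)
    rw [prod_eq_zero_of_memPattern_ne hB h₀ h₁ hz.symm, mul_zero]
  have hterm : ∀ x' : Fin n → Fin d,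
      liftMatrix B₁ V x x' * ∏ j, (if y j then ψ₁ else ψ₀) (x' j) =
        if sortByMem B₁ x' = sortByMem B₁ x then
          (if memPattern B₁ x' = y then V (memPattern B₁ x) y * Q else 0) else 0 := by
    intro x'
    simp only [liftMatrix, of_apply]
    by_cases hs : sortByMem B₁ x' = sortByMem B₁ x
    · rw [if_pos hs.symm, if_pos hs]
      split_ifs with hp
      · rw [hQ, ← prod_memPattern_sortByMem B₁ ψ₀ ψ₁ x, ← hs, prod_memPattern_sortByMem, hp]
      · rw [prod_eq_zero_of_memPattern_ne hB h₀ h₁ hp, mul_zero]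
    · rw [if_neg (Ne.symm hs), if_neg hs, zero_mul]
  rw [hrhs, mulVec, dotProduct, Finset.sum_congr rfl fun x' _ => hterm x',
    sum_sortByMem_eq_sum B₁ x fun w => if w = y then V (memPattern B₁ x) y * Q else 0]
  · simp
  · intro w hw
    split_ifs with h
    · rw [entry_eq_zero_of_phase_invariant hVinv (h ▸ hw.symm), zero_mul]
    · rfl
end

section
/- Let n be a natural number and let M be a Hermitian matrix over ℂ indexed by binary strings of length n that is phase invariant. Then there exist a phase-invariant unitary matrix V (indexed by binary strings of length n) and a real diagonal matrix D (indexed by binary strings of length n) such that M = V * D * V†. (Every phase-invariant Hermitian observable can be diagonalized by a phase-invariant unitary, so it can be measured by applying a phase-invariant unitary followed by a measurement in the hidden computational basis.) -/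
open Matrix

theorem phaseU_conj_apply {n : ℕ} (θ : ℝ) (M : Matrix (Fin n → Bool) (Fin n → Bool) ℂ)
    (x y : Fin n → Bool) :
    (phaseU n θ * M * (phaseU n θ)ᴴ) x y =
      Complex.exp (Complex.I * ((hamW x : ℂ) - hamW y) * θ) * M x y := by
  have h : (starRingEnd ℂ) (Complex.exp (Complex.I * (hamW y : ℂ) * (θ : ℂ))) =
      Complex.exp (-(Complex.I * (hamW y : ℂ) * (θ : ℂ))) := by
    rw [← Complex.exp_conj]
    simp
  rw [phaseU, diagonal_conjTranspose, mul_diagonal, diagonal_mul, Pi.star_apply,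
    ← starRingEnd_apply, h, mul_right_comm, ← Complex.exp_add]
  congr 2
  ring

/-- A matrix is phase invariant exactly when it preserves the Hamming weight. -/
theorem phase_invariant_iff {n : ℕ} (M : Matrix (Fin n → Bool) (Fin n → Bool) ℂ) :
    (∀ θ : ℝ, phaseU n θ * M * (phaseU n θ)ᴴ = M) ↔
      ∀ x y, hamW x ≠ hamW y → M x y = 0 := by
  constructor
  · intro h x y hxy
    have hne : (hamW x : ℂ) - hamW y ≠ 0 := sub_ne_zero.2 (by exact_mod_cast hxy)
    have key := congrFun₂ (h (Real.pi / ((hamW x : ℝ) - hamW y))) x y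
    rw [phaseU_conj_apply] at key
    have he : Complex.I * ((hamW x : ℂ) - hamW y) *
        ((Real.pi / ((hamW x : ℝ) - hamW y) : ℝ) : ℂ) = Real.pi * Complex.I := by
      push_cast
      field_simp
    rw [he, Complex.exp_pi_mul_I, neg_one_mul] at key
    exact self_eq_neg.1 key.symm
  · intro h θ
    ext x y
    rw [phaseU_conj_apply]
    by_cases hxy : hamW x = hamW y
    · simp [hxy]
    · simp [h x y hxy]

/-- A Hermitian matrix that is block diagonal for the fibres of `f` is diagonalized by a unitary
that is block diagonal for the fibres of `f`. -/
theorem Matrix.IsHermitian.exists_blockDiagonal_unitary {m κ : Type*} [Fintype m] [DecidableEq m]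
    [Fintype κ] [DecidableEq κ] (f : m → κ) {M : Matrix m m ℂ} (hM : M.IsHermitian)
    (hf : ∀ x y, f x ≠ f y → M x y = 0) :
    ∃ (V : Matrix m m ℂ) (d : m → ℝ), V ∈ Matrix.unitaryGroup m ℂ ∧
      (∀ x y, f x ≠ f y → V x y = 0) ∧
      M = V * Matrix.diagonal (fun y => ((d y : ℝ) : ℂ)) * Vᴴ := by
  let e := Equiv.sigmaFiberEquiv f
  let B (k : κ) : Matrix {x // f x = k} {x // f x = k} ℂ :=
    M.submatrix Subtype.val Subtype.val
  have hB (k : κ) : (B k).IsHermitian := hM.submatrix _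
  let U (k : κ) : Matrix {x // f x = k} {x // f x = k} ℂ := (hB k).eigenvectorUnitary
  let D : (Σ k, {x // f x = k}) → ℝ := fun p => (hB p.1).eigenvalues p.2
  have hU (k : κ) : U k * (U k)ᴴ = 1 :=
    Matrix.mem_unitaryGroup_iff.1 (hB k).eigenvectorUnitary.2
  have hBU (k : κ) : B k = U k * diagonal (fun i => (((hB k).eigenvalues i : ℝ) : ℂ)) * (U k)ᴴ := by
    have h := (hB k).spectral_theorem
    rw [Unitary.conjStarAlgAut_apply] at h
    exact h
  have hMB : M = (blockDiagonal' B).submatrix e.symm e.symm := by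
    suffices h : M.submatrix e e = blockDiagonal' B by
      rw [← h, submatrix_submatrix]
      simp
    ext ⟨k, x, hx⟩ ⟨l, y, hy⟩
    by_cases h : k = l
    · subst h
      rw [blockDiagonal'_apply_eq]
      rfl
    · rw [blockDiagonal'_apply_ne _ _ _ h]
      exact hf x y (by rwa [hx, hy])
  refine ⟨(blockDiagonal' U).submatrix e.symm e.symm, D ∘ e.symm, ?_, ?_, ?_⟩
  · rw [Matrix.mem_unitaryGroup_iff, star_eq_conjTranspose, conjTranspose_submatrix,
      submatrix_mul_equiv, blockDiagonal'_conjTranspose, ← blockDiagonal'_mul]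
    simp only [hU]
    rw [show (fun k => (1 : Matrix {x // f x = k} {x // f x = k} ℂ)) = 1 from rfl,
      blockDiagonal'_one, submatrix_one_equiv]
  · intro x y h
    simp [e, Equiv.sigmaFiberEquiv, blockDiagonal'_apply, h]
  · have hD : diagonal (fun y => (((D ∘ e.symm) y : ℝ) : ℂ)) =
        (blockDiagonal' fun k => diagonal fun i => (((hB k).eigenvalues i : ℝ) : ℂ)).submatrix
          e.symm e.symm := by
      rw [blockDiagonal'_diagonal, submatrix_diagonal_equiv]
      rfl
    rw [hD, conjTranspose_submatrix, submatrix_mul_equiv, submatrix_mul_equiv,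
      blockDiagonal'_conjTranspose, ← blockDiagonal'_mul, ← blockDiagonal'_mul, hMB]
    simp only [← hBU]

/-- every phase-invariant Hermitian matrix `M` (indexed by
binary strings of length `n`) can be diagonalized as `M = V * D * V†` with a
phase-invariant unitary `V` and a real diagonal matrix `D`. -/
theorem stmt18 (n : ℕ) (M : Matrix (Fin n → Bool) (Fin n → Bool) ℂ)
    (hherm : M.IsHermitian)
    (hinv : ∀ θ : ℝ, phaseU n θ * M * (phaseU n θ)ᴴ = M) :
    ∃ (V : Matrix (Fin n → Bool) (Fin n → Bool) ℂ) (d : (Fin n → Bool) → ℝ),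
      V ∈ Matrix.unitaryGroup (Fin n → Bool) ℂ ∧
      (∀ θ : ℝ, phaseU n θ * V * (phaseU n θ)ᴴ = V) ∧
      M = V * Matrix.diagonal (fun y => ((d y : ℝ) : ℂ)) * Vᴴ := by
  obtain ⟨V, d, hV, hVf, hVd⟩ := hherm.exists_blockDiagonal_unitary
    (fun y => (⟨hamW y, Nat.lt_succ_of_le ((Finset.card_le_univ _).trans_eq (Fintype.card_fin n))⟩ :
      Fin (n + 1)))
    (fun x y h => (phase_invariant_iff M).1 hinv x y fun he => h (Fin.ext he))
  exact ⟨V, d, hV,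
    (phase_invariant_iff V).2 fun x y h => hVf x y fun he => h (congrArg Fin.val he), hVd⟩
end
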